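/- arXiv:2007.05235 — 3 statements merged into one kernel-verified Lean document; each statement's English description precedes it below -/
import Mathlib

section
/- Let Ẽ be a real Banach space, F̃ a metric space, and for each p ∈ F̃ let f_p : Ẽ → Ẽ be a map which is C¹ in a neighborhood of 0. Assume: (i) for every p ∈ F̃ the continuous linear map Df_p(0) is bijective on Ẽ, the map (p,x) ↦ f_p(x) is Lipschitz on F̃ × Ẽ, and the map p ↦ Df_p(0)⁻¹ is Lipschitz (with values in the bounded linear operators on Ẽ); (ii) there exist r > 0 and M > 0 such that for all x₁, x₂ in the open ball B(0,r) of Ẽ and all p ∈ F̃, one has ‖Df_p(0)⁻¹‖ ≤ M and ‖Df_p(x₁) − Df_p(x₂)‖ ≤ 1/(2M) in operator norm. Then there exists a unique Lipschitz map R̃, defined on the set of pairs (p, y) with p ∈ F̃ and y in the open ball of Ẽ of center f_p(0) and radius r/(2M), taking values in B(0,r), such that f_p(R̃(p,y)) = y for every such pair (p,y). -/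
open scoped NNReal
open Metric

/-- **Lemma 6.3**: a parameterized inverse function theorem with quantified neighborhood,
uniform with respect to a parameter, together with Lipschitz dependence of the
solution on the parameter and the data. -/
theorem stmt1
    {E : Type*} [NormedAddCommGroup E] [NormedSpace ℝ E] [CompleteSpace E]
    {F : Type*} [MetricSpace F]
    (f : F → E → E) (Df : F → E → (E →L[ℝ] E)) (Dinv : F → E →L[ℝ] E)
    (r M : ℝ) (hr : 0 < r) (hM : 0 < M)
    -- `f p` is C¹ near 0: it has derivative `Df p x` at every point of `B(0,r)`
    (hC1 : ∀ p, ∀ x ∈ ball (0 : E) r, HasFDerivAt (f p) (Df p x) x)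
    -- (i) `Df p 0` is bijective, with inverse `Dinv p`
    (hbij₁ : ∀ p, (Df p 0).comp (Dinv p) = ContinuousLinearMap.id ℝ E)
    (hbij₂ : ∀ p, (Dinv p).comp (Df p 0) = ContinuousLinearMap.id ℝ E)
    -- (i) `(p, x) ↦ f p x` and `p ↦ (Df p 0)⁻¹` are Lipschitz
    (Kf : ℝ≥0) (hflip : LipschitzWith Kf (fun z : F × E => f z.1 z.2))
    (KD : ℝ≥0) (hDinvlip : LipschitzWith KD Dinv)
    -- (ii) uniform bounds on `B(0,r)`
    (hMbound : ∀ p, ‖Dinv p‖ ≤ M)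
    (hDosc : ∀ p, ∀ x₁ ∈ ball (0 : E) r, ∀ x₂ ∈ ball (0 : E) r,
      ‖Df p x₁ - Df p x₂‖ ≤ 1 / (2 * M)) :
    -- conclusion: a unique Lipschitz solution map on `∪_p {p} × B(f p 0, r/(2M))`,
    -- with values in `B(0,r)`, solving `f p (R̃ (p,y)) = y`
    ∃! R : {z : F × E // z.2 ∈ ball (f z.1 0) (r / (2 * M))} → E,
      (∃ K : ℝ≥0, LipschitzWith K R) ∧
      ∀ z, R z ∈ ball (0 : E) r ∧ f z.1.1 (R z) = z.1.2 := by
  have key : ∀ p, ∀ x₁ ∈ ball (0 : E) r, ∀ x₂ ∈ ball (0 : E) r,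
      ‖f p x₁ - f p x₂ - Df p 0 (x₁ - x₂)‖ ≤ 1 / (2 * M) * ‖x₁ - x₂‖ := by
    intro p x₁ h₁ x₂ h₂
    exact (convex_ball (0 : E) r).norm_image_sub_le_of_norm_hasFDerivWithin_le'
      (fun x hx => (hC1 p x hx).hasFDerivWithinAt)
      (fun x hx => hDosc p x hx 0 (mem_ball_self hr)) h₂ h₁
  have expand : ∀ p, ∀ x₁ ∈ ball (0 : E) r, ∀ x₂ ∈ ball (0 : E) r,
      ‖x₁ - x₂‖ ≤ 2 * M * ‖f p x₁ - f p x₂‖ := by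
    intro p x₁ h₁ x₂ h₂
    have e : x₁ - x₂ = Dinv p (f p x₁ - f p x₂)
        - Dinv p (f p x₁ - f p x₂ - Df p 0 (x₁ - x₂)) := by
      have h := congrArg (fun L : E →L[ℝ] E => L (x₁ - x₂)) (hbij₂ p)
      simp only [ContinuousLinearMap.comp_apply, ContinuousLinearMap.id_apply] at h
      rw [← map_sub, sub_sub_cancel, h]
    have b1 : ‖Dinv p (f p x₁ - f p x₂)‖ ≤ M * ‖f p x₁ - f p x₂‖ :=
      (Dinv p).le_of_opNorm_le (hMbound p) _
    have b2 : ‖Dinv p (f p x₁ - f p x₂ - Df p 0 (x₁ - x₂))‖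
        ≤ M * (1 / (2 * M) * ‖x₁ - x₂‖) :=
      ((Dinv p).le_of_opNorm_le (hMbound p) _).trans
        (mul_le_mul_of_nonneg_left (key p x₁ h₁ x₂ h₂) hM.le)
    have b3 : M * (1 / (2 * M) * ‖x₁ - x₂‖) = ‖x₁ - x₂‖ / 2 := by field_simp
    have b4 := norm_sub_le (Dinv p (f p x₁ - f p x₂))
      (Dinv p (f p x₁ - f p x₂ - Df p 0 (x₁ - x₂)))
    rw [← e] at b4
    linarith
  have exist : ∀ z : {z : F × E // z.2 ∈ ball (f z.1 0) (r / (2 * M))},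
      ∃ x, x ∈ ball (0 : E) r ∧ f z.1.1 x = z.1.2 := by
    rintro ⟨⟨p, y⟩, hz⟩
    simp only [mem_ball] at hz
    let c : ℝ≥0 := ⟨1 / (2 * M), by positivity⟩
    let g : (Df p 0).NonlinearRightInverse :=
      { toFun := Dinv p
        nnnorm := ⟨M, hM.le⟩
        bound' := fun y => (Dinv p).le_of_opNorm_le (hMbound p) y
        right_inv' := fun y => congrArg (fun L : E →L[ℝ] E => L y) (hbij₁ p) }
    have hA : ApproximatesLinearOn (f p) (Df p 0) (ball (0 : E) r) c :=
      fun x₁ h₁ x₂ h₂ => key p x₁ h₁ x₂ h₂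
    set ε : ℝ := 2 * M * dist y (f p 0) with hε
    have hεr : ε < r := by
      rw [lt_div_iff₀ (by positivity)] at hz
      linarith
    have hS := hA.surjOn_closedBall_of_nonlinearRightInverse g (ε := ε) (b := 0)
      (by positivity) (closedBall_subset_ball hεr)
    have hy : y ∈ closedBall (f p 0) (((g.nnnorm : ℝ)⁻¹ - c) * ε) := by
      have : ((g.nnnorm : ℝ)⁻¹ - c) * ε = dist y (f p 0) := by
        change (M⁻¹ - 1 / (2 * M)) * ε = _
        rw [hε]; field_simp; ring
      rw [this, mem_closedBall]
    obtain ⟨x, hx, hxy⟩ := hS hy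
    exact ⟨x, closedBall_subset_ball hεr hx, hxy⟩
  choose R hR using exist
  refine ⟨R, ⟨⟨⟨2 * M * (1 + Kf), by positivity⟩, LipschitzWith.of_dist_le_mul ?_⟩, hR⟩, ?_⟩
  · intro z w
    change dist (R z) (R w) ≤ 2 * M * (1 + Kf) * dist z w
    have h1 := expand z.1.1 (R z) (hR z).1 (R w) (hR w).1
    rw [dist_eq_norm]
    refine h1.trans ?_
    rw [mul_assoc (2 * M)]
    refine mul_le_mul_of_nonneg_left ?_ (by positivity)
    rw [(hR z).2, ← dist_eq_norm]
    have h2 : dist z.1.2 w.1.2 ≤ dist z w := le_max_right _ _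
    have h3 : dist z.1.1 w.1.1 ≤ dist z w := le_max_left _ _
    have h4 := hflip.dist_le_mul (w.1.1, R w) (z.1.1, R w)
    simp only [(hR w).2, Prod.dist_eq, dist_self] at h4
    rw [max_eq_left dist_nonneg, dist_comm w.1.1] at h4
    have h5 := mul_le_mul_of_nonneg_left h3 Kf.2
    have h6 := dist_triangle z.1.2 w.1.2 (f z.1.1 (R w))
    change (Kf : ℝ) * _ ≤ Kf * _ at h5
    linarith
  · rintro S ⟨-, hS⟩
    funext z
    have h := expand z.1.1 (S z) (hS z).1 (R z) (hR z).1
    rw [(hS z).2, (hR z).2, sub_self, norm_zero, mul_zero] at h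
    exact sub_eq_zero.1 (norm_le_zero_iff.1 h)
end

section
/- Let d ≥ 1, let A be a subset of ℝ^d, and let r > 0 be such that the closed Euclidean ball of center 0 and radius r is contained in the convex hull of A. Then there exist points a_1, …, a_{(d+1)²} ∈ A and smooth functions μ_1, …, μ_{(d+1)²} : ℝ^d → ℝ with μ_i(v) > 0 for every v ∈ ℝ^d and every i, such that Σ_{i=1}^{(d+1)²} μ_i(v) a_i = v for every v ∈ ℝ^d. -/
theorem pos_carath (d : ℕ) (A : Set (EuclideanSpace ℝ (Fin d)))
    (x : EuclideanSpace ℝ (Fin d)) (hx : x ∈ convexHull ℝ A) :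
    ∃ (z : Fin (d + 1) → EuclideanSpace ℝ (Fin d)) (w : Fin (d + 1) → ℝ),
      (∀ j, z j ∈ A) ∧ (∀ j, 0 < w j) ∧ ∑ j, w j • z j = x := by
  classical
  obtain ⟨ι, hι, z, w, hz, hind, hw, hsum, hxs⟩ := eq_pos_convex_span_of_mem_convexHull hx
  have hne : Nonempty ι := by
    by_contra h
    rw [not_nonempty_iff] at h
    simp at hsum
  have hcard : Fintype.card ι ≤ d + 1 := by
    have h1 := hind.card_le_finrank_succ
    have h2 := Submodule.finrank_le (vectorSpan ℝ (Set.range z))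
    rw [finrank_euclideanSpace_fin] at h2
    omega
  obtain ⟨g⟩ : Nonempty (ι ↪ Fin (d + 1)) :=
    Function.Embedding.nonempty_of_card_le (by simpa using hcard)
  let f := Function.invFun g
  have hf : Function.Surjective f := Function.invFun_surjective g.injective
  let n : ι → ℝ := fun i => ((Finset.univ.filter (fun j => f j = i)).card : ℝ)
  have hn : ∀ i, 0 < n i := by
    intro i
    obtain ⟨j, hj⟩ := hf i
    have : 0 < (Finset.univ.filter (fun j => f j = i)).card :=
      Finset.card_pos.mpr ⟨j, by simp [hj]⟩
    exact Nat.cast_pos.mpr this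
  refine ⟨fun j => z (f j), fun j => w (f j) / n (f j), fun j => hz ⟨_, rfl⟩,
    fun j => div_pos (hw _) (hn _), ?_⟩
  rw [← hxs, ← Finset.sum_fiberwise (s := Finset.univ) (g := f)]
  refine Finset.sum_congr rfl fun i _ => ?_
  rw [Finset.sum_congr rfl (g := fun _ => (w i / n i) • z i)]
  · rw [Finset.sum_const, ← Nat.cast_smul_eq_nsmul ℝ, smul_smul]
    congr 1
    exact mul_div_cancel₀ _ (hn i).ne'
  · intro j hj
    beta_reduce
    rw [(Finset.mem_filter.mp hj).2]

/-- **Lemma 6.5** (abstract form): if the closed ball `B̄(0,r)` is contained in the convex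
hull of `A ⊆ ℝ^d`, then there are `(d+1)²` points of `A` and smooth strictly positive
coefficient functions `μ_i` with `Σ_i μ_i(v) a_i = v` for every `v`. -/
theorem stmt6
    (d : ℕ) (hd : 1 ≤ d)
    (A : Set (EuclideanSpace ℝ (Fin d))) (r : ℝ) (hr : 0 < r)
    (hA : Metric.closedBall (0 : EuclideanSpace ℝ (Fin d)) r ⊆ convexHull ℝ A) :
    ∃ (a : Fin ((d + 1) ^ 2) → EuclideanSpace ℝ (Fin d))
      (μ : Fin ((d + 1) ^ 2) → EuclideanSpace ℝ (Fin d) → ℝ),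
      (∀ i, a i ∈ A) ∧
      (∀ i, ContDiff ℝ (⊤ : ℕ∞) (μ i)) ∧
      (∀ i v, 0 < μ i v) ∧
      (∀ v : EuclideanSpace ℝ (Fin d), ∑ i, μ i v • a i = v) := by
  classical
  let b : Option (Fin d) → EuclideanSpace ℝ (Fin d) := fun l =>
    l.elim (-∑ i, EuclideanSpace.single i (1 : ℝ)) (fun i => EuclideanSpace.single i (1 : ℝ))
  let lam : Option (Fin d) → EuclideanSpace ℝ (Fin d) → ℝ := fun l v =>
    l.elim (1 + ‖v‖ ^ 2) (fun i => v i + (1 + ‖v‖ ^ 2))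
  have hlam_smooth : ∀ l, ContDiff ℝ (⊤ : ℕ∞) (lam l) := by
    have h0 : ContDiff ℝ (⊤ : ℕ∞) (fun v : EuclideanSpace ℝ (Fin d) => 1 + ‖v‖ ^ 2) :=
      contDiff_const.add (contDiff_norm_sq ℝ)
    rintro (_ | i)
    · exact h0
    · have h1 : ContDiff ℝ (⊤ : ℕ∞) (fun v : EuclideanSpace ℝ (Fin d) => v i) := by fun_prop
      exact h1.add h0
  have hlam_pos : ∀ l v, 0 < lam l v := by
    rintro (_ | i) v
    · change 0 < 1 + ‖v‖ ^ 2
      positivity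
    · change 0 < v i + (1 + ‖v‖ ^ 2)
      have h := PiLp.norm_apply_le v i
      rw [Real.norm_eq_abs] at h
      have := neg_abs_le (v i)
      nlinarith [sq_nonneg (‖v‖ - 1), norm_nonneg v]
  have hdecomp : ∀ v, ∑ l, lam l v • b l = v := by
    intro v
    rw [Fintype.sum_option]
    change (1 + ‖v‖ ^ 2) • (-∑ i, EuclideanSpace.single i (1 : ℝ)) +
      ∑ i, (v i + (1 + ‖v‖ ^ 2)) • EuclideanSpace.single i (1 : ℝ) = v
    simp only [add_smul _ (1 + ‖v‖ ^ 2), Finset.sum_add_distrib, ← Finset.smul_sum, smul_neg]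
    rw [add_comm, add_neg_cancel_right]
    ext k
    simp [Finset.sum_apply, Pi.single_apply]
  have hpos : ∀ l, 0 < r / (1 + ‖b l‖) := fun l => by positivity
  have hmem : ∀ l, (r / (1 + ‖b l‖)) • b l ∈ convexHull ℝ A := by
    intro l
    apply hA
    rw [mem_closedBall_zero_iff, norm_smul, Real.norm_of_nonneg (hpos l).le, div_mul_eq_mul_div,
      div_le_iff₀ (by positivity)]
    nlinarith
  choose z w hz hw hs using fun l => pos_carath d A _ (hmem l)
  let e : Fin ((d + 1) ^ 2) ≃ Option (Fin d) × Fin (d + 1) :=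
    (Fintype.equivFinOfCardEq (by simp [sq])).symm
  refine ⟨fun i => z (e i).1 (e i).2,
    fun i v => lam (e i).1 v * ((r / (1 + ‖b (e i).1‖))⁻¹ * w (e i).1 (e i).2),
    fun i => hz _ _, fun i => (hlam_smooth _).mul contDiff_const,
    fun i v => mul_pos (hlam_pos _ _) (mul_pos (inv_pos.mpr (hpos _)) (hw _ _)), fun v => ?_⟩
  rw [e.sum_comp (fun p => (lam p.1 v * ((r / (1 + ‖b p.1‖))⁻¹ * w p.1 p.2)) • z p.1 p.2),
    Fintype.sum_prod_type]
  conv_rhs => rw [← hdecomp v]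
  refine Finset.sum_congr rfl fun l _ => ?_
  simp only [mul_smul, ← Finset.smul_sum]
  rw [hs, inv_smul_smul₀ (hpos l).ne']
end

section
/- Let m, n ≥ 1, let E ⊆ ℝ^m and F₀ ⊆ ℝ^n be measurable sets of finite positive Lebesgue measure, let ω₀ : F₀ → ℝ be a bounded measurable function, let C > 0, β ∈ (0,1) and c > 0. Consider the set A(ω₀) of all functions of the form ω₀ ∘ Ψ : E → ℝ, where Ψ : E → F₀ ranges over the maps that are β-Hölder continuous with Hölder constant at most C and satisfy that the pushforward under Ψ of the Lebesgue measure restricted to E equals c times the Lebesgue measure restricted to F₀. Then A(ω₀) is a totally bounded subset of L³(E); in particular A(ω₀) is relatively compact in L³(E). -/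
open MeasureTheory
open scoped NNReal ENNReal

theorem exists_holder_delta (C β : ℝ≥0) (hβ0 : 0 < β) {r : ℝ} (hr : 0 < r) :
    ∃ δ : ℝ, 0 < δ ∧ (C : ℝ) * δ ^ (β : ℝ) < r := by
  have hC : (0 : ℝ) < C + 1 := by positivity
  have hb : (β : ℝ) ≠ 0 := by exact_mod_cast hβ0.ne'
  refine ⟨(r / (C + 1)) ^ ((β : ℝ)⁻¹), by positivity, ?_⟩
  rw [← Real.rpow_mul (by positivity), inv_mul_cancel₀ hb, Real.rpow_one, ← mul_div_assoc,
    div_lt_iff₀ hC]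
  nlinarith

theorem tb_main
    (m n : ℕ)
    (E : Set (EuclideanSpace ℝ (Fin m))) (F₀ : Set (EuclideanSpace ℝ (Fin n)))
    (hEmeas : MeasurableSet E) (hF₀meas : MeasurableSet F₀)
    (hEfin : volume E < ⊤) (hF₀fin : volume F₀ < ⊤)
    (ω₀ : EuclideanSpace ℝ (Fin n) → ℝ) (hω₀meas : Measurable ω₀)
    (Cb : ℝ) (hω₀bdd : ∀ x ∈ F₀, |ω₀ x| ≤ Cb)
    (C β : ℝ≥0) (hβ0 : 0 < β)
    (c : ℝ)
    [Fact ((1 : ℝ≥0∞) ≤ 3)] :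
    TotallyBounded
      {h : Lp ℝ 3 (volume.restrict E) |
        ∃ Ψ : EuclideanSpace ℝ (Fin m) → EuclideanSpace ℝ (Fin n),
          Set.MapsTo Ψ E F₀ ∧ HolderOnWith C β Ψ E ∧
          Measure.map Ψ (volume.restrict E) = ENNReal.ofReal c • volume.restrict F₀ ∧
          ⇑h =ᵐ[volume.restrict E] (ω₀ ∘ Ψ)} := by
  have hF : Fact (volume F₀ < ⊤) := ⟨hF₀fin⟩
  have hfm : IsFiniteMeasure (ENNReal.ofReal c • volume.restrict F₀) :=
    Measure.smul_finite _ ENNReal.ofReal_ne_top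
  have h13 : (1 : ℝ≥0∞) ≤ 3 := Fact.out
  have hmem : MemLp ω₀ 3 (ENNReal.ofReal c • volume.restrict F₀) := by
    refine MemLp.of_bound hω₀meas.aestronglyMeasurable Cb ?_
    refine Measure.ae_smul_measure ?_ _
    filter_upwards [ae_restrict_mem hF₀meas] with x hx using hω₀bdd x hx
  refine Metric.totallyBounded_of_finite_discretization fun ε hε => ?_
  have hη : 0 < ε / 5 := by positivity
  generalize hηe : ε / 5 = η at hη
  obtain ⟨g, hgs, hgle, hgc, -⟩ := hmem.exists_hasCompactSupport_eLpNorm_sub_le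
    (by simp) (ε := ENNReal.ofReal η) (by simpa using hη)
  obtain ⟨M, hM⟩ := hgs.exists_bound_of_continuous hgc
  have hM0 : 0 ≤ M := (norm_nonneg _).trans (hM 0)
  have hgu := hgs.uniformContinuous_of_continuous hgc
  -- the oscillation scale
  obtain ⟨a, ha, haV⟩ : ∃ a : ℝ, 0 < a ∧
      (volume E) ^ (3 : ℝ)⁻¹ * ENNReal.ofReal (3 * a) ≤ ENNReal.ofReal η := by
    have hV : volume E ^ (3 : ℝ)⁻¹ ≠ ⊤ := ENNReal.rpow_ne_top_of_nonneg (by positivity) hEfin.ne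
    lift volume E ^ (3 : ℝ)⁻¹ to ℝ≥0 using hV with V
    refine ⟨η / (3 * (V + 1)), by positivity, ?_⟩
    rw [← ENNReal.ofReal_coe_nnreal, ← ENNReal.ofReal_mul (by positivity)]
    apply ENNReal.ofReal_le_ofReal
    have : (V : ℝ) * (3 * (η / (3 * (V + 1)))) = η * (V / (V + 1)) := by field_simp
    rw [this]
    have h1 : (V : ℝ) / (V + 1) ≤ 1 := by
      rw [div_le_one (by positivity)]; linarith
    nlinarith
  obtain ⟨K, hKE, hK, hEK⟩ := hEmeas.exists_isCompact_sdiff_lt hEfin.ne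
    (ε := ENNReal.ofReal (η / (2 * M + 1)) ^ (3 : ℝ))
    (by
      have : 0 < η / (2 * M + 1) := by positivity
      simp [ENNReal.rpow_eq_zero_iff, this])
  have hEK' : volume (E \ K) ^ (3 : ℝ)⁻¹ * ENNReal.ofReal (2 * M) ≤ ENNReal.ofReal η := by
    have h1 : volume (E \ K) ^ (3 : ℝ)⁻¹ ≤ ENNReal.ofReal (η / (2 * M + 1)) := by
      rw [ENNReal.rpow_inv_le_iff (by norm_num)]; exact hEK.le
    calc _ ≤ ENNReal.ofReal (η / (2 * M + 1)) * ENNReal.ofReal (2 * M) := by gcongr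
      _ ≤ _ := by
        rw [← ENNReal.ofReal_mul (by positivity)]
        apply ENNReal.ofReal_le_ofReal
        rw [div_mul_eq_mul_div, div_le_iff₀ (by positivity)]
        nlinarith
  obtain ⟨r, hr, hgr⟩ := Metric.uniformContinuous_iff.1 hgu a ha
  obtain ⟨δ, hδ, hCδ⟩ := exists_holder_delta C β hβ0 hr
  obtain ⟨t, htK, htf, hcov⟩ := hK.finite_cover_balls hδ
  have htF : Fintype t := htf.fintype
  have hKm := hK.measurableSet
  choose Ψ hΨ using fun h : {h : Lp ℝ 3 (volume.restrict E) |
        ∃ Ψ : EuclideanSpace ℝ (Fin m) → EuclideanSpace ℝ (Fin n),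
          Set.MapsTo Ψ E F₀ ∧ HolderOnWith C β Ψ E ∧
          Measure.map Ψ (volume.restrict E) = ENNReal.ofReal c • volume.restrict F₀ ∧
          ⇑h =ᵐ[volume.restrict E] (ω₀ ∘ Ψ)} => h.2
  have hcode : ∀ y, ⌊g y / a⌋ ∈ Set.Icc ⌊-M / a⌋ ⌊M / a⌋ := fun y => by
    have := abs_le.1 (hM y)
    constructor <;> apply Int.floor_mono <;> gcongr <;> linarith
  have hΨm : ∀ h, AEMeasurable (Ψ h) (volume.restrict E) := fun h =>
    ((hΨ h).2.1.continuousOn hβ0).aemeasurable hEmeas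
  have happ : ∀ h, eLpNorm (g ∘ Ψ h - ⇑h.1) 3 (volume.restrict E) ≤ ENNReal.ofReal η := fun h => by
    obtain ⟨-, -, hmap, hae⟩ := hΨ h
    rw [eLpNorm_sub_comm]
    have h1 : (⇑h.1 - g ∘ Ψ h) =ᵐ[volume.restrict E] (ω₀ - g) ∘ Ψ h := by
      filter_upwards [hae] with x hx
      simp [hx]
    rw [eLpNorm_congr_ae h1, ← eLpNorm_map_measure _ (hΨm h), hmap]
    · exact hgle
    · exact (hω₀meas.sub hgc.measurable).aestronglyMeasurable
  have hosc : ∀ h, ∀ x ∈ E, ∀ y ∈ E, dist x y < δ → |g (Ψ h x) - g (Ψ h y)| < a := by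
    intro h x hx y hy hxy
    exact hgr (((hΨ h).2.1.dist_le_of_le hx hy hxy.le).trans_lt hCδ)
  have hgΨ : ∀ h, AEStronglyMeasurable (g ∘ Ψ h) (volume.restrict E) := fun h =>
    (hgc.measurable.comp_aemeasurable (hΨm h)).aestronglyMeasurable
  refine ⟨t → Set.Icc ⌊-M / a⌋ ⌊M / a⌋, inferInstance, fun h i => ⟨_, hcode (Ψ h i)⟩, ?_⟩
  intro h k hhk
  have hfl : ∀ i ∈ t, |g (Ψ h i) - g (Ψ k i)| < a := by
    intro i hi
    have h1 := congrArg Subtype.val (congrFun hhk ⟨i, hi⟩)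
    have h2 := Int.abs_sub_lt_one_of_floor_eq_floor h1
    rwa [← sub_div, abs_div, abs_of_pos ha, div_lt_one ha] at h2
  have hclose : ∀ x ∈ K, ‖(g ∘ Ψ h - g ∘ Ψ k) x‖ ≤ 3 * a := by
    intro x hx
    obtain ⟨i, hi, hxi⟩ := Set.mem_iUnion₂.1 (hcov hx)
    have h1 := abs_lt.1 (hosc h x (hKE hx) i (hKE (htK hi)) hxi)
    have h2 := abs_lt.1 (hosc k x (hKE hx) i (hKE (htK hi)) hxi)
    have h3 := abs_lt.1 (hfl i hi)
    simp only [Pi.sub_apply, Function.comp, Real.norm_eq_abs]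
    rw [abs_le]
    constructor <;> linarith [h1.1, h1.2, h2.1, h2.2, h3.1, h3.2]
  have hmid : eLpNorm (g ∘ Ψ h - g ∘ Ψ k) 3 (volume.restrict E)
      ≤ ENNReal.ofReal η + ENNReal.ofReal η := by
    have hsm := (hgΨ h).sub (hgΨ k)
    rw [← Set.indicator_self_add_compl K (g ∘ Ψ h - g ∘ Ψ k)]
    refine (eLpNorm_add_le (hsm.indicator hKm) (hsm.indicator hKm.compl) h13).trans ?_
    rw [eLpNorm_indicator_eq_eLpNorm_restrict hKm,
      eLpNorm_indicator_eq_eLpNorm_restrict hKm.compl]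
    gcongr
    · refine (eLpNorm_le_of_ae_bound (C := 3 * a) ?_).trans (le_trans ?_ haV)
      · filter_upwards [ae_restrict_mem hKm] with x hx using hclose x hx
      · simp only [Measure.restrict_apply_univ, ENNReal.toReal_ofNat]
        gcongr
        exact Measure.restrict_le_self
    · refine (eLpNorm_le_of_ae_bound (C := 2 * M) ?_).trans (le_trans ?_ hEK')
      · refine Filter.Eventually.of_forall fun x => ?_
        have h1 := hM (Ψ h x)
        have h2 := hM (Ψ k x)
        refine (norm_sub_le _ _).trans ?_
        simp only [Function.comp]
        linarith
      · rw [Measure.restrict_apply_univ, Measure.restrict_apply hKm.compl,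
          Set.inter_comm, ← Set.sdiff_eq, ENNReal.toReal_ofNat]
  have hk := happ k
  have hh := happ h
  rw [eLpNorm_sub_comm] at hh
  have htot : eLpNorm (⇑h.1 - ⇑k.1) 3 (volume.restrict E) ≤ ENNReal.ofReal (4 * η) := by
    have e : (⇑h.1 - ⇑k.1) = (⇑h.1 - g ∘ Ψ h) + ((g ∘ Ψ h - g ∘ Ψ k) + (g ∘ Ψ k - ⇑k.1)) := by
      abel
    have hs1 := (Lp.aestronglyMeasurable h.1).sub (hgΨ h)
    have hs2 := (hgΨ h).sub (hgΨ k)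
    have hs3 := (hgΨ k).sub (Lp.aestronglyMeasurable k.1)
    rw [e]
    refine (eLpNorm_add_le hs1 (hs2.add hs3) h13).trans ?_
    refine (add_le_add hh ((eLpNorm_add_le hs2 hs3 h13).trans
      (add_le_add hmid hk))).trans ?_
    rw [← ENNReal.ofReal_add hη.le hη.le, ← ENNReal.ofReal_add (by positivity) hη.le,
      ← ENNReal.ofReal_add hη.le (by positivity)]
    apply ENNReal.ofReal_le_ofReal
    linarith
  rw [Lp.dist_def]
  refine (ENNReal.toReal_le_of_le_ofReal (by positivity) htot).trans_lt ?_
  linarith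

/-- The compactness lemma of Section 8.4: the set of compositions `ω₀ ∘ Ψ` of a bounded
measurable function with uniformly `β`-Hölder maps pushing the Lebesgue measure on `E`
to `c` times the Lebesgue measure on `F₀` is totally bounded, hence relatively compact,
in `L³(E)`. -/
theorem stmt12
    (m n : ℕ) (hm : 1 ≤ m) (hn : 1 ≤ n)
    (E : Set (EuclideanSpace ℝ (Fin m))) (F₀ : Set (EuclideanSpace ℝ (Fin n)))
    (hEmeas : MeasurableSet E) (hF₀meas : MeasurableSet F₀)
    (hEpos : 0 < volume E) (hEfin : volume E < ⊤)
    (hF₀pos : 0 < volume F₀) (hF₀fin : volume F₀ < ⊤)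
    (ω₀ : EuclideanSpace ℝ (Fin n) → ℝ) (hω₀meas : Measurable ω₀)
    (Cb : ℝ) (hω₀bdd : ∀ x ∈ F₀, |ω₀ x| ≤ Cb)
    (C β : ℝ≥0) (hC : 0 < C) (hβ0 : 0 < β) (hβ1 : (β : ℝ) < 1)
    (c : ℝ) (hc : 0 < c)
    [Fact ((1 : ℝ≥0∞) ≤ 3)] :
    TotallyBounded
      {h : Lp ℝ 3 (volume.restrict E) |
        ∃ Ψ : EuclideanSpace ℝ (Fin m) → EuclideanSpace ℝ (Fin n),
          Set.MapsTo Ψ E F₀ ∧ HolderOnWith C β Ψ E ∧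
          Measure.map Ψ (volume.restrict E) = ENNReal.ofReal c • volume.restrict F₀ ∧
          ⇑h =ᵐ[volume.restrict E] (ω₀ ∘ Ψ)} ∧
    IsCompact (closure
      {h : Lp ℝ 3 (volume.restrict E) |
        ∃ Ψ : EuclideanSpace ℝ (Fin m) → EuclideanSpace ℝ (Fin n),
          Set.MapsTo Ψ E F₀ ∧ HolderOnWith C β Ψ E ∧
          Measure.map Ψ (volume.restrict E) = ENNReal.ofReal c • volume.restrict F₀ ∧
          ⇑h =ᵐ[volume.restrict E] (ω₀ ∘ Ψ)}) := by
  have h := tb_main m n E F₀ hEmeas hF₀meas hEfin hF₀fin ω₀ hω₀meas Cb hω₀bdd C β hβ0 c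
  exact ⟨h, isCompact_iff_totallyBounded_isComplete.2 ⟨h.closure, isClosed_closure.isComplete⟩⟩
end
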